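/- arXiv:1804.00212 — 2 statements merged into one kernel-verified Lean document; each statement's English description precedes it below -/
import Mathlib

section
/- Let d ≥ 3 be an integer, 0 < α < 2, and ρ > 0. Then there exists a constant C > 0, depending only on d, α and ρ, such that for every z ∈ ℝ^d with 0 < |z| ≤ 1, ∫_0^1 q_ρ(t,z) dt ≤ C / |z|^{d−2}, where q_ρ(t,z) = t^{−d/2} exp(−ρ|z|²/t) + min(t^{−d/2}, t/|z|^{d+α}). -/
open MeasureTheory

/-- The Gaussian factor absorbs the singularity of a negative power at the origin. -/
lemma rpow_neg_mul_exp_neg_div_le {s b t : ℝ} (hs : 0 < s) (hb : 0 < b) (ht : 0 < t) :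
    t ^ (-s) * Real.exp (-b / t) ≤ (s / b) ^ s := by
  have h1 : b / t / s ≤ Real.exp (b / t / s) := by
    linarith [Real.add_one_le_exp (b / t / s)]
  have h2 : (b / t / s) ^ s ≤ Real.exp (b / t) := by
    calc (b / t / s) ^ s ≤ (Real.exp (b / t / s)) ^ s :=
          Real.rpow_le_rpow (by positivity) h1 hs.le
      _ = Real.exp (b / t) := by
          rw [← Real.exp_mul]; congr 1; field_simp
  have h3 : t ^ (-s) = (s / b) ^ s * (b / t / s) ^ s := by
    rw [← Real.mul_rpow (by positivity) (by positivity), Real.rpow_neg ht.le,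
      ← Real.inv_rpow ht.le]
    congr 1; field_simp
  have h4 : Real.exp (-b / t) = (Real.exp (b / t))⁻¹ := by
    rw [← Real.exp_neg]; congr 1; ring
  rw [h3, h4, mul_assoc]
  refine mul_le_of_le_one_right (by positivity) ?_
  rw [← div_eq_mul_inv]
  exact (div_le_one (Real.exp_pos _)).2 h2

/-- A function dominated by a constant multiple of `min (a ^ (-s)) (t ^ (-s))`, with `s > 1`, has
integral of order `a ^ (1 - s)`. -/
lemma setIntegral_le_of_le_rpow_neg {f : ℝ → ℝ} {s a K L : ℝ} (hs : 1 < s) (ha : 0 < a)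
    (hK : 0 ≤ K) (hL : 0 ≤ L) (hf : ∀ t ∈ Set.Ioc (0 : ℝ) 1, 0 ≤ f t)
    (hsmall : ∀ t ∈ Set.Ioc (0 : ℝ) 1, t ≤ a → f t ≤ K * a ^ (-s))
    (hlarge : ∀ t ∈ Set.Ioc (0 : ℝ) 1, a < t → f t ≤ L * t ^ (-s)) :
    ∫ t in Set.Ioc (0 : ℝ) 1, f t ≤ (K + L / (s - 1)) * a ^ (1 - s) := by
  have hi₁ : Integrable ((Set.Ioc 0 a).indicator fun _ : ℝ => K * a ^ (-s)) :=
    (integrable_indicator_iff measurableSet_Ioc).2 (integrableOn_const (by simp))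
  have hi₂ : Integrable ((Set.Ioi a).indicator fun t : ℝ => L * t ^ (-s)) :=
    (integrable_indicator_iff measurableSet_Ioi).2
      ((integrableOn_Ioi_rpow_of_lt (by linarith) ha).const_mul L)
  rw [← integral_indicator measurableSet_Ioc]
  calc ∫ t, (Set.Ioc (0 : ℝ) 1).indicator f t
      ≤ ∫ t, ((Set.Ioc 0 a).indicator (fun _ : ℝ => K * a ^ (-s)) t +
          (Set.Ioi a).indicator (fun t : ℝ => L * t ^ (-s)) t) := by
        refine integral_mono_of_nonneg (.of_forall fun t => Set.indicator_nonneg hf t)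
          (hi₁.add hi₂) (.of_forall fun t => ?_)
        have hg₁ : 0 ≤ (Set.Ioc 0 a).indicator (fun _ : ℝ => K * a ^ (-s)) t :=
          Set.indicator_nonneg (fun _ _ => by positivity) t
        have hg₂ : 0 ≤ (Set.Ioi a).indicator (fun t : ℝ => L * t ^ (-s)) t :=
          Set.indicator_nonneg (fun t ht => mul_nonneg hL
            (Real.rpow_nonneg (ha.le.trans (le_of_lt ht)) _)) t
        by_cases ht : t ∈ Set.Ioc (0 : ℝ) 1
        · simp only [Set.indicator_of_mem ht]
          rcases le_or_gt t a with hta | hta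
          · rw [Set.indicator_of_mem (show t ∈ Set.Ioc 0 a from ⟨ht.1, hta⟩)]
            linarith [hsmall t ht hta]
          · rw [Set.indicator_of_mem (show t ∈ Set.Ioi a from hta)]
            linarith [hlarge t ht hta]
        · simp only [Set.indicator_of_notMem ht]
          exact add_nonneg hg₁ hg₂
    _ = (K + L / (s - 1)) * a ^ (1 - s) := by
        rw [integral_add hi₁ hi₂, integral_indicator measurableSet_Ioc,
          integral_indicator measurableSet_Ioi, setIntegral_const, integral_const_mul,
          integral_Ioi_rpow_of_lt (by linarith) ha]
        have h1 : a ^ (1 - s) = a * a ^ (-s) := by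
          rw [sub_eq_add_neg, Real.rpow_add ha, Real.rpow_one]
        have h2 : s - 1 ≠ 0 := by linarith
        have h3 : -s + 1 = -(s - 1) := by ring
        rw [show a ^ (-s + 1) = a ^ (1 - s) by ring_nf, h3, neg_div_neg_eq, h1]
        simp [measureReal_def, ha.le]
        ring

/-- For `d ≥ 3`, `0 < α < 2`, `ρ > 0`, there is `C > 0` with
`∫_0^1 q_ρ(t,z) dt ≤ C/|z|^{d-2}` for all `0 < |z| ≤ 1`, where
`q_ρ(t,z) = t^{-d/2} exp(-ρ|z|²/t) + min(t^{-d/2}, t/|z|^{d+α})`. -/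
theorem green_kernel_upper_bound_dim_ge_three
    (d : ℕ) (hd : 3 ≤ d) (α ρ : ℝ) (hα0 : 0 < α) (hα2 : α < 2) (hρ : 0 < ρ) :
    ∃ C > (0 : ℝ), ∀ z : EuclideanSpace ℝ (Fin d), 0 < ‖z‖ → ‖z‖ ≤ 1 →
      (∫ t in Set.Ioc (0 : ℝ) 1,
          (t ^ (-(d : ℝ) / 2) * Real.exp (-ρ * ‖z‖ ^ 2 / t) +
            min (t ^ (-(d : ℝ) / 2)) (t / ‖z‖ ^ ((d : ℝ) + α)))) ≤
        C / ‖z‖ ^ ((d : ℝ) - 2) := by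
  have hd' : (3 : ℝ) ≤ d := by exact_mod_cast hd
  obtain ⟨s, hs⟩ : ∃ s : ℝ, s = d / 2 := ⟨_, rfl⟩
  have hs1 : 1 < s := by linarith
  have hs0 : 0 < s - 1 := by linarith
  refine ⟨(s / ρ) ^ s + 1 + 2 / (s - 1), by positivity, fun z hz hz1 => ?_⟩
  generalize ‖z‖ = r at hz hz1
  have hpow : ∀ p : ℝ, (r ^ 2) ^ p = r ^ (2 * p) := fun p => by
    rw [← Real.rpow_natCast, ← Real.rpow_mul hz.le, Nat.cast_ofNat]
  have hfinal : (r ^ 2) ^ (1 - s) = (r ^ ((d : ℝ) - 2))⁻¹ := by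
    rw [hpow, ← Real.rpow_neg hz.le]; congr 1; rw [hs]; ring
  rw [div_eq_mul_inv _ (r ^ ((d : ℝ) - 2)), ← hfinal, show -(d : ℝ) / 2 = -s by rw [hs]; ring]
  refine setIntegral_le_of_le_rpow_neg hs1 (by positivity) (by positivity) zero_le_two
    (fun t ht => ?_) (fun t ht hta => ?_) fun t ht _ => ?_
  · have := ht.1
    positivity
  · have h1 := rpow_neg_mul_exp_neg_div_le (by linarith : 0 < s)
      (by positivity : 0 < ρ * r ^ 2) ht.1
    have h2 : (s / (ρ * r ^ 2)) ^ s = (s / ρ) ^ s * (r ^ 2) ^ (-s) := by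
      rw [← div_div, Real.div_rpow (by positivity) (by positivity),
        Real.rpow_neg (by positivity), div_eq_mul_inv]
    have h3 : t / r ^ ((d : ℝ) + α) ≤ (r ^ 2) ^ (-s) := by
      calc t / r ^ ((d : ℝ) + α) ≤ r ^ 2 / r ^ ((d : ℝ) + α) := by gcongr
        _ = r ^ (2 - ((d : ℝ) + α)) := by
            rw [Real.rpow_sub hz, Real.rpow_two]
        _ ≤ r ^ (2 * -s) :=
            Real.rpow_le_rpow_of_exponent_ge hz hz1 (by rw [hs]; linarith)
        _ = (r ^ 2) ^ (-s) := (hpow _).symm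
    rw [h2, ← neg_mul] at h1
    linarith [min_le_right (t ^ (-s)) (t / r ^ ((d : ℝ) + α))]
  · have h1 : Real.exp (-ρ * r ^ 2 / t) ≤ 1 := by
      rw [Real.exp_le_one_iff, neg_mul, neg_div]
      have := ht.1
      exact neg_nonpos.2 (by positivity)
    have h2 := mul_le_of_le_one_right (Real.rpow_nonneg ht.1.le (-s)) h1
    linarith [min_le_left (t ^ (-s)) (t / r ^ ((d : ℝ) + α))]
end

section
/- Let d = 2, 0 < α < 2, and ρ > 0. Then there exists a constant C > 0, depending only on α and ρ, such that for every z ∈ ℝ² with 0 < |z| ≤ 1, ∫_0^1 q_ρ(t,z) dt ≤ C · ln(1 + 1/|z|), where q_ρ(t,z) = t^{−1} exp(−ρ|z|²/t) + min(t^{−1}, t/|z|^{2+α}). -/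
open MeasureTheory

lemma inv_mul_exp_neg_div_le {ρ s t : ℝ} (hρ : 0 < ρ) (hs : 0 < s) (ht : 0 < t) :
    t⁻¹ * Real.exp (-ρ * s / t) ≤ (1 + 1 / ρ) * (t + s)⁻¹ := by
  set x := ρ * s / t with hx
  have hx0 : 0 < x := by positivity
  have hst : s = x * t / ρ := by rw [hx]; field_simp
  have he : Real.exp (-ρ * s / t) = Real.exp (-x) := by rw [hx]; congr 1; ring
  have h1 : Real.exp (-x) ≤ 1 := Real.exp_le_one_iff.2 (by linarith)
  have h2 : x * Real.exp (-x) ≤ 1 := by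
    rw [Real.exp_neg, mul_inv_le_iff₀ (Real.exp_pos x)]
    linarith [Real.add_one_le_exp x]
  rw [he, ← div_eq_mul_inv, le_div_iff₀ (by positivity)]
  calc t⁻¹ * Real.exp (-x) * (t + s) = Real.exp (-x) + x * Real.exp (-x) / ρ := by
        rw [hst]; field_simp
    _ ≤ 1 + 1 / ρ := by gcongr

lemma min_inv_div_rpow_le {α r t : ℝ} (hα : α < 2) (hr : 0 < r) (hr1 : r ≤ 1) (ht : 0 < t) :
    min t⁻¹ (t / r ^ ((2 : ℝ) + α)) ≤ 2 * (t + r ^ 2)⁻¹ := by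
  rw [← div_eq_mul_inv, le_div_iff₀ (by positivity)]
  rcases le_total t (r ^ 2) with h | h
  · have hp : r ^ (4 : ℕ) ≤ r ^ ((2 : ℝ) + α) := by
      rw [← Real.rpow_natCast]
      exact Real.rpow_le_rpow_of_exponent_ge hr hr1 (by push_cast; linarith)
    calc min t⁻¹ (t / r ^ ((2 : ℝ) + α)) * (t + r ^ 2)
        ≤ t / r ^ ((2 : ℝ) + α) * (t + r ^ 2) := by gcongr; exact min_le_right _ _
      _ ≤ r ^ 2 / r ^ 4 * (r ^ 2 + r ^ 2) := by gcongr
      _ = 2 := by field_simp; ring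
  · calc min t⁻¹ (t / r ^ ((2 : ℝ) + α)) * (t + r ^ 2)
        ≤ t⁻¹ * (t + t) := by gcongr; exact min_le_left _ _
      _ = 2 := by field_simp; ring

lemma intervalIntegrable_inv_add {s : ℝ} (hs : 0 < s) :
    IntervalIntegrable (fun t : ℝ => (t + s)⁻¹) volume 0 1 := by
  refine ContinuousOn.intervalIntegrable fun t ht => ?_
  rw [Set.uIcc_of_le zero_le_one] at ht
  have : t + s ≠ 0 := by linarith [ht.1]
  fun_prop (disch := assumption)

lemma integral_inv_add {s : ℝ} (hs : 0 < s) :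
    ∫ t in (0 : ℝ)..1, (t + s)⁻¹ = Real.log (1 + 1 / s) := by
  rw [intervalIntegral.integral_comp_add_right (fun t => t⁻¹),
    integral_inv_of_pos (by linarith) (by linarith)]
  congr 1
  field_simp
  ring

lemma log_one_add_one_div_sq_le {r : ℝ} (hr : 0 < r) :
    Real.log (1 + 1 / r ^ 2) ≤ 2 * Real.log (1 + 1 / r) := by
  rw [show 2 * Real.log (1 + 1 / r) = Real.log ((1 + 1 / r) ^ 2) by
    rw [Real.log_pow]; norm_num]
  apply Real.log_le_log (by positivity)
  have : 0 < 1 / r := by positivity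
  rw [← one_div_pow]
  nlinarith

/-- For `d = 2`, `0 < α < 2`, `ρ > 0`, there is `C > 0` with
`∫_0^1 q_ρ(t,z) dt ≤ C ln(1 + 1/|z|)` for all `0 < |z| ≤ 1`, where
`q_ρ(t,z) = t⁻¹ exp(-ρ|z|²/t) + min(t⁻¹, t/|z|^{2+α})`. -/
theorem green_kernel_upper_bound_dim_two
    (α ρ : ℝ) (hα0 : 0 < α) (hα2 : α < 2) (hρ : 0 < ρ) :
    ∃ C > (0 : ℝ), ∀ z : EuclideanSpace ℝ (Fin 2), 0 < ‖z‖ → ‖z‖ ≤ 1 →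
      (∫ t in Set.Ioc (0 : ℝ) 1,
          (t⁻¹ * Real.exp (-ρ * ‖z‖ ^ 2 / t) +
            min t⁻¹ (t / ‖z‖ ^ ((2 : ℝ) + α)))) ≤
        C * Real.log (1 + 1 / ‖z‖) := by
  refine ⟨(3 + 1 / ρ) * 2, by positivity, fun z hz hz1 => ?_⟩
  generalize ‖z‖ = r at hz hz1
  have hr2 : 0 < r ^ 2 := by positivity
  calc _ ≤ ∫ t in Set.Ioc (0 : ℝ) 1, (3 + 1 / ρ) * (t + r ^ 2)⁻¹ := by
        refine integral_mono_of_nonneg ?_ ?_ ?_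
        · filter_upwards [ae_restrict_mem measurableSet_Ioc] with t ht
          have := ht.1
          simp only [Pi.zero_apply]
          positivity
        · exact (intervalIntegrable_inv_add hr2).1.const_mul _
        · filter_upwards [ae_restrict_mem measurableSet_Ioc] with t ht
          have h1 := inv_mul_exp_neg_div_le hρ hr2 ht.1
          have h2 := min_inv_div_rpow_le hα2 hz hz1 ht.1
          linarith
    _ = (3 + 1 / ρ) * Real.log (1 + 1 / r ^ 2) := by
        rw [integral_const_mul, ← intervalIntegral.integral_of_le zero_le_one,
          integral_inv_add hr2]
    _ ≤ (3 + 1 / ρ) * 2 * Real.log (1 + 1 / r) := by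
        rw [mul_assoc]
        gcongr
        exact log_one_add_one_div_sq_le hz
end
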